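/- arXiv:2001.10707 — 3 statements merged into one kernel-verified Lean document; each statement's English description precedes it below -/
import Mathlib

section
/- Fix a set A ∈ 𝔅 and a constant β_NL ∈ ℝ, and assume the density of the coupling J_A satisfies P_A(−x) = exp(−2 β_NL x) P_A(x) for all x ∈ ℝ. Then for every measurable even function f : ℝ → ℝ with f ≥ 0 (and assuming all quenched averages below are finite), the quenched average of the local energy satisfies E[ −J_A f(J_A) ⟨σ_A⟩_J ] ≥ E[ −J_A f(J_A) tanh(β J_A) − J_A f(J_A) (1 − e^{−β_NL J_A}) / sinh(2β J_A) ], where the right-hand side involves only the distribution of J_A and is independent of all other couplings. -/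
open MeasureTheory Real Finset ProbabilityTheory

/-- The spin value of a Boolean: `true ↦ 1`, `false ↦ -1`. -/
noncomputable def spinVal (b : Bool) : ℝ := if b then 1 else -1

/-- `σ_B = ∏ i ∈ B, σ_i`. -/
noncomputable def sigmaSet {V : Type} (σ : V → Bool) (B : Finset V) : ℝ :=
  ∏ i ∈ B, spinVal (σ i)

/-- The Gibbs (thermal) average `⟨σ_A⟩_J` at inverse temperature `β` for the Hamiltonian
`H(σ) = -∑_{B ∈ ℬ} J_B σ_B`. -/
noncomputable def gibbsAvg {V : Type} [Fintype V] [DecidableEq V] (β : ℝ)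
    (ℬ : Finset (Finset V)) (J : ℬ → ℝ) (A : Finset V) : ℝ :=
  (∑ σ : V → Bool, sigmaSet σ A * Real.exp (β * ∑ B : ℬ, J B * sigmaSet σ (B : Finset V))) /
  (∑ σ : V → Bool, Real.exp (β * ∑ B : ℬ, J B * sigmaSet σ (B : Finset V)))

/-- The product measure `∏_{B ∈ ℬ} P_B(J_B) dJ_B` of the independent random couplings. -/
noncomputable def quenchedMeasure {V : Type} (ℬ : Finset (Finset V))
    (P : Finset V → ℝ → ℝ) : Measure (ℬ → ℝ) :=
  Measure.pi fun B => volume.withDensity fun x => ENNReal.ofReal (P (B : Finset V) x)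

theorem abs_spinVal (b : Bool) : |spinVal b| = 1 := by cases b <;> simp [spinVal]

theorem abs_sigmaSet {V : Type} (σ : V → Bool) (B : Finset V) : |sigmaSet σ B| = 1 := by
  simp [sigmaSet, Finset.abs_prod, abs_spinVal]

theorem exp_mul_eq_cosh_add_mul_sinh {s : ℝ} (hs : |s| = 1) (y : ℝ) :
    exp (y * s) = cosh y + s * sinh y := by
  rcases eq_or_eq_neg_of_abs_eq hs with rfl | rfl
  · simp
  · simp [← Real.cosh_sub_sinh, sub_eq_add_neg]

/-- The Gibbs average of `σ_A` as a Möbius function of `tanh (β J_A)`, in terms of the partition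
function `Z` and the unnormalized average `M` of `σ_A` at `J_A = 0`. -/
theorem exists_gibbsAvg_update_eq {V : Type} [Fintype V] [DecidableEq V] (β : ℝ)
    (ℬ : Finset (Finset V)) (A : ℬ) (J : ℬ → ℝ) :
    ∃ Z M : ℝ, 0 < Z ∧ |M| ≤ Z ∧ ∀ x, gibbsAvg β ℬ (Function.update J A x) A =
      (sinh (β * x) * Z + cosh (β * x) * M) / (cosh (β * x) * Z + sinh (β * x) * M) := by
  let w : (V → Bool) → ℝ := fun σ =>
    exp (β * ∑ B ∈ univ.erase A, J B * sigmaSet σ (B : Finset V))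
  have hexp (x : ℝ) (σ : V → Bool) :
      exp (β * ∑ B : ℬ, Function.update J A x B * sigmaSet σ (B : Finset V)) =
        (cosh (β * x) + sigmaSet σ A * sinh (β * x)) * w σ := by
    rw [← Finset.add_sum_erase _ _ (mem_univ A), mul_add, Real.exp_add, Function.update_self,
      ← mul_assoc, exp_mul_eq_cosh_add_mul_sinh (abs_sigmaSet σ A)]
    congr 3
    refine Finset.sum_congr rfl fun B hB => ?_
    rw [Function.update_of_ne (ne_of_mem_erase hB)]
  have hsq (σ : V → Bool) : sigmaSet σ A * sigmaSet σ A = 1 := by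
    rw [← abs_mul_abs_self, abs_sigmaSet, one_mul]
  refine ⟨∑ σ, w σ, ∑ σ, sigmaSet σ A * w σ,
    Finset.sum_pos (fun σ _ => exp_pos _) univ_nonempty, ?_, fun x => ?_⟩
  · refine (abs_sum_le_sum_abs _ _).trans_eq (Finset.sum_congr rfl fun σ _ => ?_)
    rw [abs_mul, abs_sigmaSet, one_mul, abs_of_pos (exp_pos _)]
  · simp only [gibbsAvg, hexp]
    simp only [Finset.mul_sum, ← Finset.sum_add_distrib]
    congr 1
    · refine Finset.sum_congr rfl fun σ _ => ?_
      linear_combination (sinh (β * x) * w σ) * hsq σ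
    · refine Finset.sum_congr rfl fun σ _ => ?_
      ring

theorem cosh_mul_add_sinh_mul_pos {Z M : ℝ} (hZ : 0 < Z) (hM : |M| ≤ Z) (y : ℝ) :
    0 < cosh y * Z + sinh y * M := by
  have h1 : |sinh y * M| ≤ |sinh y| * Z := by
    rw [abs_mul]; gcongr
  have h2 : |sinh y| < cosh y := abs_lt.2 ⟨by
    have := Real.cosh_add_sinh y; have := exp_pos y; linarith, Real.sinh_lt_cosh y⟩
  have h3 := mul_lt_mul_of_pos_right h2 hZ
  have := neg_abs_le (sinh y * M)
  linarith

/-- The maximum of `⟨σ_A⟩_x - u² ⟨σ_A⟩_{-x}` over the other couplings, written for `y = β J_A`. -/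
theorem mul_sub_sq_mul_le {Z M : ℝ} (hZ : 0 < Z) (hM : |M| ≤ Z) (u : ℝ) {x y : ℝ}
    (hxy : 0 < x * y) :
    x * ((sinh y * Z + cosh y * M) / (cosh y * Z + sinh y * M)
        - u ^ 2 * ((-sinh y * Z + cosh y * M) / (cosh y * Z + -sinh y * M))) ≤
      x * (tanh y * (1 + u ^ 2) + (1 - u) ^ 2 / sinh (2 * y)) := by
  have hy : y ≠ 0 := right_ne_zero_of_mul hxy.ne'
  have hp := cosh_mul_add_sinh_mul_pos hZ hM y
  have hq := cosh_mul_add_sinh_mul_pos hZ hM (-y)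
  rw [Real.cosh_neg, Real.sinh_neg] at hq
  have hc := Real.cosh_pos y
  have hs : sinh y ≠ 0 := Real.sinh_ne_zero.2 hy
  have hcs := Real.cosh_sq y
  have hxs : 0 < x * sinh y := by
    rcases pos_and_pos_or_neg_and_neg_of_mul_pos hxy with ⟨hx, hy⟩ | ⟨hx, hy⟩
    · exact mul_pos hx (Real.sinh_pos_iff.2 hy)
    · exact mul_pos_of_neg_of_neg hx (Real.sinh_neg_iff.2 hy)
  have key : x * (tanh y * (1 + u ^ 2) + (1 - u) ^ 2 / sinh (2 * y))
      - x * ((sinh y * Z + cosh y * M) / (cosh y * Z + sinh y * M)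
        - u ^ 2 * ((-sinh y * Z + cosh y * M) / (cosh y * Z + -sinh y * M))) =
      (x * sinh y) * ((cosh y * Z + -sinh y * M) - u * (cosh y * Z + sinh y * M)) ^ 2 /
        (2 * sinh y ^ 2 * cosh y * (cosh y * Z + sinh y * M) * (cosh y * Z + -sinh y * M)) := by
    rw [Real.tanh_eq_sinh_div_cosh, Real.sinh_two_mul]
    generalize sinh y = s at *
    generalize cosh y = c at *
    rw [neg_mul s M, ← sub_eq_add_neg] at hq ⊢
    have hp' := hp.ne'
    have hq' := hq.ne'
    field_simp
    grind
  rw [← sub_nonneg, key]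
  positivity

theorem pi_withDensity_eq_withDensity_prod {ι : Type*} [Fintype ι] {Ω : ι → Type*}
    [∀ i, MeasurableSpace (Ω i)] (μ : ∀ i, Measure (Ω i)) [∀ i, IsProbabilityMeasure (μ i)]
    {w : ∀ i, Ω i → ENNReal} (hw : ∀ i, Measurable (w i))
    [∀ i, SigmaFinite ((μ i).withDensity (w i))] :
    Measure.pi (fun i => (μ i).withDensity (w i)) =
      (Measure.pi μ).withDensity fun x => ∏ i, w i (x i) := by
  refine Measure.pi_eq fun s hs => ?_
  have hm (i : ι) : Measurable ((s i).indicator (w i)) := (hw i).indicator (hs i)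
  calc (Measure.pi μ).withDensity (fun x => ∏ i, w i (x i)) (Set.univ.pi s)
      = ∫⁻ x, ∏ i, (s i).indicator (w i) (x i) ∂Measure.pi μ := by
        rw [withDensity_apply _ (MeasurableSet.univ_pi hs),
          ← lintegral_indicator (MeasurableSet.univ_pi hs)]
        refine lintegral_congr fun x => ?_
        by_cases hx : x ∈ Set.univ.pi s
        · rw [Set.indicator_of_mem hx]
          exact Finset.prod_congr rfl fun i _ =>
            (Set.indicator_of_mem (hx i (Set.mem_univ i)) _).symm
        · rw [Set.indicator_of_notMem hx]
          obtain ⟨i, hi⟩ : ∃ i, x i ∉ s i := by simpa [Set.mem_pi] using hx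
          exact (Finset.prod_eq_zero (mem_univ i) (Set.indicator_of_notMem hi _)).symm
    _ = ∏ i, ∫⁻ x, (s i).indicator (w i) (x i) ∂Measure.pi μ :=
        lintegral_prod_eq_prod_lintegral_of_indepFun univ
          (fun i (x : ∀ i, Ω i) => (s i).indicator (w i) (x i))
          (iIndepFun_pi fun i => (hm i).aemeasurable)
          fun i => (hm i).comp (measurable_pi_apply i)
    _ = ∏ i, (μ i).withDensity (w i) (s i) := by
        refine Finset.prod_congr rfl fun i _ => ?_
        rw [withDensity_apply _ (hs i), ← lintegral_indicator (hs i),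
          (measurePreserving_eval μ i).lintegral_comp (hm i)]

theorem map_neg_withDensity {p w : ℝ → ENNReal} (hp : Measurable p) (hw : Measurable w)
    (h : ∀ x, p (-x) = w x * p x) :
    ((volume : Measure ℝ).withDensity p).map (fun x => -x) =
      ((volume : Measure ℝ).withDensity p).withDensity w := by
  rw [← withDensity_mul _ hp hw]
  ext s hs
  rw [Measure.map_apply measurable_neg hs, withDensity_apply _ (measurable_neg hs),
    withDensity_apply _ hs, ← lintegral_indicator (measurable_neg hs), ← lintegral_indicator hs,
    ← lintegral_neg_eq_self]
  refine lintegral_congr fun x => ?_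
  by_cases hx : x ∈ s
  · simp [hx, h, mul_comm]
  · simp [hx]

theorem map_update_neg_quenchedMeasure {V : Type} [DecidableEq V] {ℬ : Finset (Finset V)}
    {P : Finset V → ℝ → ℝ} (hPmeas : ∀ B, Measurable (P B)) (hPnonneg : ∀ B x, 0 ≤ P B x)
    (hPone : ∀ B, ∫ x, P B x = 1) (A : ℬ) {w : ℝ → ℝ} (hw : Measurable w) (hw0 : ∀ x, 0 ≤ w x)
    (hPw : ∀ x, P A (-x) = w x * P A x) :
    (quenchedMeasure ℬ P).map (fun J => Function.update J A (-J A)) =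
      (quenchedMeasure ℬ P).withDensity fun J => ENNReal.ofReal (w (J A)) := by
  let μ : ℬ → Measure ℝ := fun B => volume.withDensity fun x => ENNReal.ofReal (P B x)
  have hμ (B : ℬ) : IsProbabilityMeasure (μ B) := ⟨by
    have hint : Integrable (P B) := by
      by_contra h
      simpa [integral_undef h] using hPone B
    rw [withDensity_apply _ MeasurableSet.univ, Measure.restrict_univ,
      ← ofReal_integral_eq_lintegral_ofReal hint (ae_of_all _ (hPnonneg B)), hPone,
      ENNReal.ofReal_one]⟩
  let r : ℬ → ℝ → ℝ := fun B x => if B = A then -x else x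
  have hr (B : ℬ) : Measurable (r B) := by
    by_cases hB : B = A
    · simpa [r, hB] using measurable_neg
    · simp only [r, hB, if_false]
      exact measurable_id
  let d : ℬ → ℝ → ENNReal := fun B x => if B = A then ENNReal.ofReal (w x) else 1
  have hd (B : ℬ) : Measurable (d B) := by
    by_cases hB : B = A
    · simpa [d, hB] using hw.ennreal_ofReal
    · simp [d, hB]
  have hmap (B : ℬ) : (μ B).map (r B) = (μ B).withDensity (d B) := by
    by_cases hB : B = A
    · subst hB
      simp only [r, d, if_true]
      refine map_neg_withDensity (hPmeas B).ennreal_ofReal hw.ennreal_ofReal fun x => ?_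
      rw [hPw, ENNReal.ofReal_mul (hw0 x)]
    · simp only [r, d, hB, if_false]
      rw [Measure.map_id', ← Pi.one_def, withDensity_one]
  have hprob (B : ℬ) : IsProbabilityMeasure ((μ B).map (r B)) :=
    Measure.isProbabilityMeasure_map (hr B).aemeasurable
  have hσ (B : ℬ) : SigmaFinite ((μ B).withDensity (d B)) := by
    rw [← hmap]; infer_instance
  have hupdate : (fun J : ℬ → ℝ => Function.update J A (-J A)) = fun J B => r B (J B) := by
    ext J B
    by_cases hB : B = A
    · subst hB; simp [r]
    · simp [r, hB]
  have hprod : (fun J : ℬ → ℝ => ENNReal.ofReal (w (J A))) = fun J => ∏ B, d B (J B) := by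
    ext J
    simp [d]
  change (Measure.pi μ).map _ = (Measure.pi μ).withDensity _
  rw [hupdate, hprod, Measure.pi_map_pi fun B => (hr B).aemeasurable,
    ← pi_withDensity_eq_withDensity_prod μ hd]
  simp only [hmap]

/-- If the push-forward of `μ` under an involution `T` has density `w`, then `D` has nonnegative
integral as soon as its symmetrization `D + w • (D ∘ T)` is nonnegative. -/
theorem integral_nonneg_of_map_eq_withDensity {Ω : Type*} [MeasurableSpace Ω] {μ : Measure Ω}
    {T : Ω → Ω} (hT : Measurable T) (hTT : Function.Involutive T) {w : Ω → ℝ} (hw : Measurable w)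
    (hw0 : ∀ x, 0 ≤ w x) (hμ : μ.map T = μ.withDensity fun x => ENNReal.ofReal (w x))
    {D : Ω → ℝ} (hD : Integrable D μ) (h : ∀ x, 0 ≤ D x + w x * D (T x)) :
    0 ≤ ∫ x, D x ∂μ := by
  let e : Ω ≃ᵐ Ω := ⟨hTT.toPerm, hT, hT⟩
  have hcomp : (fun x => D (T (T x))) = D := funext fun x => congrArg D (hTT x)
  have hi : Integrable (fun x => w x * D (T x)) μ := by
    have : Integrable (fun x => D (T x)) (μ.map e) := by
      rw [integrable_map_equiv]
      change Integrable (fun x => D (T (T x))) μ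
      rwa [hcomp]
    change Integrable _ (μ.map T) at this
    rw [hμ, integrable_withDensity_iff_integrable_smul' hw.ennreal_ofReal
      (ae_of_all _ fun _ => ENNReal.ofReal_lt_top)] at this
    simpa [ENNReal.toReal_ofReal (hw0 _)] using this
  have heq : ∫ x, w x * D (T x) ∂μ = ∫ x, D x ∂μ := by
    calc ∫ x, w x * D (T x) ∂μ = ∫ x, D (T x) ∂(μ.map T) := by
          rw [hμ, integral_withDensity_eq_integral_toReal_smul hw.ennreal_ofReal
            (ae_of_all _ fun _ => ENNReal.ofReal_lt_top)]
          simp [ENNReal.toReal_ofReal (hw0 _)]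
      _ = ∫ x, D (T (T x)) ∂μ := integral_map_equiv e fun x => D (T x)
      _ = ∫ x, D x ∂μ := by rw [hcomp]
  have := integral_nonneg (μ := μ) (f := fun x => D x + w x * D (T x)) h
  rw [integral_add hD hi, heq] at this
  linarith

/-- **Theorem 1 (asymmetric distribution).** If the density of `J_A` satisfies
`P_A(-x) = exp(-2 β_NL x) P_A(x)`, then for every nonnegative measurable even `f`,
`E[-J_A f(J_A) ⟨σ_A⟩_J] ≥ E[-J_A f(J_A) tanh(β J_A) - J_A f(J_A)(1 - e^{-β_NL J_A})/sinh(2β J_A)]`,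
the integrand on the right being extended continuously (by the value `0`) at `J_A = 0`. -/
theorem local_energy_lower_bound_asymmetric
    {V : Type} [Fintype V] [DecidableEq V]
    (ℬ : Finset (Finset V)) (hℬ : ∀ B ∈ ℬ, B.Nonempty)
    (β : ℝ) (hβ : 0 < β)
    (P : Finset V → ℝ → ℝ)
    (hPmeas : ∀ B, Measurable (P B))
    (hPnonneg : ∀ B x, 0 ≤ P B x)
    (hPone : ∀ B, ∫ x, P B x = 1)
    (A : Finset V) (hA : A ∈ ℬ)
    (βNL : ℝ)
    (hPasym : ∀ x : ℝ, P A (-x) = Real.exp (-2 * βNL * x) * P A x)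
    (f : ℝ → ℝ) (hfmeas : Measurable f) (hfeven : ∀ x, f (-x) = f x)
    (hfnonneg : ∀ x, 0 ≤ f x)
    -- the right-hand-side integrand, extended continuously to `x = 0`
    (g : ℝ → ℝ) (hg0 : g 0 = 0)
    (hg : ∀ x : ℝ, x ≠ 0 → g x = -x * f x * Real.tanh (β * x)
        - x * f x * (1 - Real.exp (-(βNL * x))) / Real.sinh (2 * β * x))
    -- finiteness of the quenched averages
    (hint1 : Integrable
      (fun J : ℬ → ℝ => -(J ⟨A, hA⟩) * f (J ⟨A, hA⟩) * gibbsAvg β ℬ J A)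
      (quenchedMeasure ℬ P))
    (hint2 : Integrable (fun J : ℬ → ℝ => g (J ⟨A, hA⟩)) (quenchedMeasure ℬ P)) :
    ∫ J, -(J ⟨A, hA⟩) * f (J ⟨A, hA⟩) * gibbsAvg β ℬ J A ∂(quenchedMeasure ℬ P)
      ≥ ∫ J, g (J ⟨A, hA⟩) ∂(quenchedMeasure ℬ P) := by
  let a : ℬ := ⟨A, hA⟩
  let w : ℝ → ℝ := fun x => exp (-2 * βNL * x)
  have hw : Measurable w := by fun_prop
  rw [ge_iff_le, ← sub_nonneg, ← integral_sub hint1 hint2]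
  have hflip : Measurable fun J : ℬ → ℝ => Function.update J a (-J a) := by
    refine measurable_pi_iff.2 fun B => ?_
    by_cases hB : B = a
    · simpa [hB] using measurable_pi_apply (X := fun _ : ℬ => ℝ) a
    · simpa [hB] using measurable_pi_apply B
  have hinvol : Function.Involutive fun J : ℬ → ℝ => Function.update J a (-J a) :=
    fun J => by simp
  refine integral_nonneg_of_map_eq_withDensity hflip hinvol
    (hw.comp (measurable_pi_apply a)) (fun J => (exp_pos _).le)
    (map_update_neg_quenchedMeasure hPmeas hPnonneg hPone a hw (fun x => (exp_pos _).le) hPasym)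
    (hint1.sub hint2) fun J => ?_
  obtain ⟨Z, M, hZ, hM, hgibbs⟩ := exists_gibbsAvg_update_eq β ℬ a J
  have hJ := hgibbs (J a)
  rw [Function.update_eq_self] at hJ
  change gibbsAvg β ℬ J A = _ at hJ
  have hJneg : gibbsAvg β ℬ (Function.update J a (-J a)) A = _ := hgibbs (-J a)
  change 0 ≤ (-(J a) * f (J a) * gibbsAvg β ℬ J A - g (J a)) + w (J a) *
    (-(Function.update J a (-J a) a) * f (Function.update J a (-J a) a) *
      gibbsAvg β ℬ (Function.update J a (-J a)) A - g (Function.update J a (-J a) a))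
  rw [hJ, hJneg, Function.update_self, hfeven]
  generalize J a = x
  rcases eq_or_ne x 0 with rfl | hx
  · simp [hg0]
  have hxy : 0 < x * (β * x) := by
    have := mul_pos hβ (mul_self_pos.2 hx)
    linarith
  have hw' : w x = exp (-(βNL * x)) ^ 2 := by
    rw [← Real.exp_nat_mul]
    change exp _ = exp _
    congr 1
    push_cast
    ring
  have hu : exp (-(βNL * x)) * exp (- -(βNL * x)) = 1 := by
    rw [← Real.exp_add]
    simp
  have hmain := mul_le_mul_of_nonneg_left
    (mul_sub_sq_mul_le hZ hM (exp (-(βNL * x))) hxy) (hfnonneg x)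
  rw [hg x hx, hg (-x) (neg_ne_zero.2 hx), hfeven, hw']
  simp only [mul_assoc 2 β, mul_neg, Real.tanh_neg, Real.sinh_neg, Real.cosh_neg]
  refine (sub_nonneg.2 hmain).trans_eq ?_
  generalize exp (- -(βNL * x)) = v at *
  generalize exp (-(βNL * x)) = u at *
  simp only [div_eq_mul_inv, inv_neg]
  linear_combination (x * f x * (sinh (2 * (β * x)))⁻¹ * u) * hu
end

section
/- Fix A ∈ 𝔅 and β_NL ∈ ℝ, and assume the density of J_A satisfies P_A(−x) = exp(−2 β_NL x) P_A(x) for all x ∈ ℝ. Then for every measurable even function f : ℝ → ℝ with f ≥ 0 (assuming the quenched average below is finite), the quenched average of f(J_A) Γ(β, J_A) is nonnegative: E[ f(J_A) Γ(β, J_A) ] ≥ 0. -/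
open MeasureTheory Real Finset ProbabilityTheory

/-- `Γ(β, J_A) = -J_A ⟨σ_A⟩_J + J_A tanh(β J_A) + (1 - e^{-β_NL J_A}) J_A / sinh(2β J_A)`,
as a function of the couplings `J`, extended continuously (by its limit value `0`) at
`J_A = 0`. -/
noncomputable def GammaQ {V : Type} [Fintype V] [DecidableEq V] (β βNL : ℝ)
    (ℬ : Finset (Finset V)) (A : Finset V) (hA : A ∈ ℬ) (J : ℬ → ℝ) : ℝ :=
  if J ⟨A, hA⟩ = 0 then 0 else
    -(J ⟨A, hA⟩) * gibbsAvg β ℬ J A + J ⟨A, hA⟩ * Real.tanh (β * J ⟨A, hA⟩)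
      + (1 - Real.exp (-(βNL * J ⟨A, hA⟩))) * J ⟨A, hA⟩
          / Real.sinh (2 * β * J ⟨A, hA⟩)

/-- A product of measures on `ℝ` with nonnegative integrable densities has the product density. -/
theorem pi_withDensity_ofReal {ι : Type*} [Fintype ι] (p : ι → ℝ → ℝ)
    (hnn : ∀ i x, 0 ≤ p i x) (hint : ∀ i, Integrable (p i)) :
    Measure.pi (fun i => (volume : Measure ℝ).withDensity fun x => ENNReal.ofReal (p i x)) =
      (volume : Measure (ι → ℝ)).withDensity fun x => ENNReal.ofReal (∏ i, p i (x i)) := by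
  have hfin : ∀ i, IsFiniteMeasure
      ((volume : Measure ℝ).withDensity fun x => ENNReal.ofReal (p i x)) := fun i =>
    isFiniteMeasure_withDensity_ofReal (hint i).2
  refine Measure.pi_eq fun s hs => ?_
  have hbox : MeasurableSet (Set.pi Set.univ s) := MeasurableSet.univ_pi hs
  have hI : ∀ i, Integrable ((s i).indicator (p i)) := fun i => (hint i).indicator (hs i)
  have hprod := integral_fintype_prod_volume_eq_prod (𝕜 := ℝ) fun i => (s i).indicator (p i)
  have hIprod : Integrable fun x : ι → ℝ => ∏ i, (s i).indicator (p i) (x i) :=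
    Integrable.fintype_prod hI
  have hnn' : ∀ i x, 0 ≤ (s i).indicator (p i) x := fun i x =>
    Set.indicator_nonneg (fun y _ => hnn i y) x
  have hind : ∀ x : ι → ℝ, ENNReal.ofReal (∏ i, (s i).indicator (p i) (x i)) =
      (Set.pi Set.univ s).indicator (fun x => ENNReal.ofReal (∏ i, p i (x i))) x := by
    intro x
    by_cases hx : x ∈ Set.pi Set.univ s
    · rw [Set.indicator_of_mem hx]
      congr 1
      exact Finset.prod_congr rfl fun i _ => Set.indicator_of_mem (hx i trivial) _
    · rw [Set.indicator_of_notMem hx]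
      simp only [Set.mem_pi, Set.mem_univ, true_imp_iff, not_forall] at hx
      obtain ⟨i, hi⟩ := hx
      rw [Finset.prod_eq_zero (Finset.mem_univ i) (Set.indicator_of_notMem hi _),
        ENNReal.ofReal_zero]
  rw [withDensity_apply _ hbox, ← lintegral_indicator hbox, ← lintegral_congr hind,
    ← ofReal_integral_eq_lintegral_ofReal hIprod
      (ae_of_all _ fun x => Finset.prod_nonneg fun i _ => hnn' i (x i)),
    hprod, ENNReal.ofReal_prod_of_nonneg fun i _ => integral_nonneg (hnn' i)]
  refine Finset.prod_congr rfl fun i _ => ?_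
  rw [withDensity_apply _ (hs i), integral_indicator (hs i),
    ofReal_integral_eq_lintegral_ofReal (hint i).integrableOn (ae_of_all _ (hnn i))]

/-- Reversing the sign of one coordinate preserves Lebesgue measure. -/
theorem measurePreserving_update_neg {ι : Type*} [Fintype ι] [DecidableEq ι] (a : ι) :
    MeasurePreserving (fun J : ι → ℝ => Function.update J a (-J a)) := by
  have h := volume_preserving_pi (α' := fun _ : ι => ℝ) (β' := fun _ : ι => ℝ)
    (f := fun i x => if i = a then -x else x) fun i => by
      by_cases hi : i = a
      · simpa [hi] using Measure.measurePreserving_neg (volume : Measure ℝ)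
      · simp only [hi, if_false]
        exact MeasurePreserving.id (volume : Measure ℝ)
  convert h using 2 with J
  ext i
  by_cases hi : i = a
  · subst hi; simp
  · simp [hi]

theorem sigmaSet_mul_self {V : Type} (σ : V → Bool) (B : Finset V) :
    sigmaSet σ B * sigmaSet σ B = 1 := by
  unfold sigmaSet
  rw [← Finset.prod_mul_distrib]
  refine Finset.prod_eq_one fun i _ => ?_
  unfold spinVal
  split <;> norm_num

theorem abs_gibbsAvg_le_one {V : Type} [Fintype V] [DecidableEq V] (β : ℝ)
    (ℬ : Finset (Finset V)) (J : ℬ → ℝ) (A : Finset V) : |gibbsAvg β ℬ J A| ≤ 1 := by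
  unfold gibbsAvg
  rw [abs_div]
  refine div_le_one_of_le₀ ((Finset.abs_sum_le_sum_abs _ _).trans ?_) (abs_nonneg _)
  refine le_trans (le_of_eq (Finset.sum_congr rfl fun σ _ => ?_)) (le_abs_self _)
  rw [abs_mul, abs_sigmaSet, one_mul, abs_of_pos (Real.exp_pos _)]

theorem exp_mul_sigmaSet {V : Type} (σ : V → Bool) (A : Finset V) (y : ℝ) :
    Real.exp (y * sigmaSet σ A) = Real.cosh y + sigmaSet σ A * Real.sinh y := by
  rcases mul_self_eq_one_iff.mp (sigmaSet_mul_self σ A) with h | h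
  · rw [h, mul_one, one_mul, Real.cosh_add_sinh]
  · rw [h, mul_neg_one, neg_one_mul, ← sub_eq_add_neg, Real.cosh_sub_sinh]

/-- The dependence of `⟨σ_A⟩` on the coupling `J_A`, in terms of its value at `J_A = 0`. -/
theorem gibbsAvg_eq_update_zero {V : Type} [Fintype V] [DecidableEq V] (β : ℝ)
    (ℬ : Finset (Finset V)) (J : ℬ → ℝ) (A : Finset V) (hA : A ∈ ℬ) :
    gibbsAvg β ℬ J A =
      (gibbsAvg β ℬ (Function.update J ⟨A, hA⟩ 0) A + Real.tanh (β * J ⟨A, hA⟩)) /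
        (1 + gibbsAvg β ℬ (Function.update J ⟨A, hA⟩ 0) A * Real.tanh (β * J ⟨A, hA⟩)) := by
  set a : ℬ := ⟨A, hA⟩ with ha
  set y := β * J a with hy
  set w : (V → Bool) → ℝ := fun σ =>
    Real.exp (β * ∑ B : ℬ, Function.update J a 0 B * sigmaSet σ (B : Finset V)) with hw
  have hexp : ∀ σ : V → Bool, Real.exp (β * ∑ B : ℬ, J B * sigmaSet σ (B : Finset V)) =
      (Real.cosh y + sigmaSet σ A * Real.sinh y) * w σ := by
    intro σ
    have hsum : ∑ B : ℬ, J B * sigmaSet σ (B : Finset V) =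
        J a * sigmaSet σ A + ∑ B : ℬ, Function.update J a 0 B * sigmaSet σ (B : Finset V) := by
      rw [← sub_eq_iff_eq_add, ← Finset.sum_sub_distrib, Finset.sum_eq_single a]
      · simp [ha]
      · intro B _ hB
        simp [hB]
      · simp
    rw [hsum, ← exp_mul_sigmaSet, hw, ← Real.exp_add, hy]
    congr 1
    ring
  have hN : ∑ σ : V → Bool, sigmaSet σ A *
      Real.exp (β * ∑ B : ℬ, J B * sigmaSet σ (B : Finset V)) =
      (∑ σ, sigmaSet σ A * w σ) * Real.cosh y + (∑ σ, w σ) * Real.sinh y := by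
    rw [Finset.sum_mul, Finset.sum_mul, ← Finset.sum_add_distrib]
    refine Finset.sum_congr rfl fun σ _ => ?_
    rw [hexp]
    linear_combination (w σ * Real.sinh y) * sigmaSet_mul_self σ A
  have hD : ∑ σ : V → Bool, Real.exp (β * ∑ B : ℬ, J B * sigmaSet σ (B : Finset V)) =
      (∑ σ, w σ) * Real.cosh y + (∑ σ, sigmaSet σ A * w σ) * Real.sinh y := by
    rw [Finset.sum_mul, Finset.sum_mul, ← Finset.sum_add_distrib]
    refine Finset.sum_congr rfl fun σ _ => ?_
    rw [hexp]
    ring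
  have hr : gibbsAvg β ℬ (Function.update J a 0) A =
      (∑ σ, sigmaSet σ A * w σ) / ∑ σ, w σ := rfl
  have hC : 0 < ∑ σ, w σ := Finset.sum_pos (fun σ _ => Real.exp_pos _) Finset.univ_nonempty
  have hc := Real.cosh_pos y
  rw [hr, gibbsAvg, hN, hD, Real.tanh_eq_sinh_div_cosh]
  have hmul : (∑ σ, sigmaSet σ A * w σ) * Real.cosh y + (∑ σ, w σ) * Real.sinh y =
      ((∑ σ, sigmaSet σ A * w σ) / (∑ σ, w σ) + Real.sinh y / Real.cosh y) *
        ((∑ σ, w σ) * Real.cosh y) := by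
    field_simp
  have hmul' : (∑ σ, w σ) * Real.cosh y + (∑ σ, sigmaSet σ A * w σ) * Real.sinh y =
      (1 + (∑ σ, sigmaSet σ A * w σ) / (∑ σ, w σ) * (Real.sinh y / Real.cosh y)) *
        ((∑ σ, w σ) * Real.cosh y) := by
    field_simp
  rw [hmul, hmul', mul_div_mul_right _ _ (mul_pos hC hc).ne']

/-- The sum over the two signs of the coupling, weighted by the density ratio `q ^ 2`. It is a
perfect square up to a positive factor. -/
theorem sign_pair_nonneg {x t r q s : ℝ} (ht : t ^ 2 < 1) (hr : |r| ≤ 1) (hq : 0 < q)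
    (hs : s * (1 - t ^ 2) = 2 * t) (hxt : 0 < x * t) :
    0 ≤ (-x * ((r + t) / (1 + r * t)) + x * t + (1 - q) * x / s) +
      q ^ 2 * (x * ((r - t) / (1 - r * t)) + x * t + (1 - q⁻¹) * x / s) := by
  have ht0 : t ≠ 0 := by rintro rfl; simp at hxt
  have h1 : 0 < 1 - t ^ 2 := by linarith
  have hrt : |r * t| < 1 := by
    rw [abs_mul]
    have : |t| < 1 := by rwa [← sq_lt_one_iff_abs_lt_one]
    nlinarith [abs_nonneg t, abs_nonneg r]
  obtain ⟨hl, hu⟩ := abs_lt.mp hrt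
  have hp : 0 < 1 + r * t := by linarith
  have hm : 0 < 1 - r * t := by linarith
  have hs' : s = 2 * t / (1 - t ^ 2) := by rw [eq_div_iff h1.ne', hs]
  have key : (-x * ((r + t) / (1 + r * t)) + x * t + (1 - q) * x / s) +
      q ^ 2 * (x * ((r - t) / (1 - r * t)) + x * t + (1 - q⁻¹) * x / s) =
      (x * t) * (1 - t ^ 2) * (q * (1 + r * t) - (1 - r * t)) ^ 2 /
        (2 * t ^ 2 * ((1 + r * t) * (1 - r * t))) := by
    rw [hs']
    field_simp
    ring
  rw [key]
  positivity

/-- Pairing a configuration of couplings with the one where `J_A` is reversed. -/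
theorem GammaQ_add_update_neg_nonneg {V : Type} [Fintype V] [DecidableEq V] {β : ℝ} (hβ : 0 < β)
    (βNL : ℝ) (ℬ : Finset (Finset V)) (A : Finset V) (hA : A ∈ ℬ) (J : ℬ → ℝ) :
    0 ≤ GammaQ β βNL ℬ A hA J + Real.exp (-2 * βNL * J ⟨A, hA⟩) *
      GammaQ β βNL ℬ A hA (Function.update J ⟨A, hA⟩ (-J ⟨A, hA⟩)) := by
  by_cases hx : J ⟨A, hA⟩ = 0
  · simp [GammaQ, hx]
  have hm := gibbsAvg_eq_update_zero β ℬ J A hA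
  have hm' := gibbsAvg_eq_update_zero β ℬ (Function.update J ⟨A, hA⟩ (-J ⟨A, hA⟩)) A hA
  have hr := abs_gibbsAvg_le_one β ℬ (Function.update J ⟨A, hA⟩ 0) A
  simp only [Function.update_idem, Function.update_self, mul_neg, Real.tanh_neg] at hm'
  simp only [GammaQ, Function.update_self, neg_eq_zero, hx, if_false, hm, hm']
  generalize gibbsAvg β ℬ (Function.update J ⟨A, hA⟩ 0) A = r at hr
  generalize J ⟨A, hA⟩ = x at hx
  have ht : Real.tanh (β * x) ^ 2 < 1 := Real.tanh_sq_lt_one _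
  have hs : Real.sinh (2 * β * x) * (1 - Real.tanh (β * x) ^ 2) = 2 * Real.tanh (β * x) := by
    have hc := (Real.cosh_pos (β * x)).ne'
    rw [mul_assoc, Real.sinh_two_mul, Real.tanh_eq_sinh_div_cosh]
    field_simp
    linear_combination Real.cosh_sq (β * x)
  have hxt : 0 < x * Real.tanh (β * x) := by
    rw [Real.tanh_eq_sinh_div_cosh, ← mul_div_assoc]
    refine div_pos ?_ (Real.cosh_pos _)
    rcases lt_or_gt_of_ne hx with h | h
    · exact mul_pos_of_neg_of_neg h (Real.sinh_neg_iff.mpr (mul_neg_of_pos_of_neg hβ h))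
    · exact mul_pos h (Real.sinh_pos_iff.mpr (mul_pos hβ h))
  have h := sign_pair_nonneg ht hr (Real.exp_pos (-(βNL * x))) hs hxt
  have hq : Real.exp (-2 * βNL * x) = Real.exp (-(βNL * x)) ^ 2 := by
    rw [← Real.exp_nat_mul]
    congr 1
    push_cast
    ring
  rw [hq]
  refine h.trans_eq ?_
  rw [← Real.exp_neg]
  simp only [mul_neg, neg_neg, Real.sinh_neg, Real.tanh_neg, neg_mul, neg_div_neg_eq,
    ← sub_eq_add_neg]

/-- If the density of `J_A` satisfies `P_A(-x) = exp(-2 β_NL x) P_A(x)`, then for every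
nonnegative measurable even `f`, the quenched average `E[f(J_A) Γ(β, J_A)]` is nonnegative. -/
theorem quenched_Gamma_nonneg
    {V : Type} [Fintype V] [DecidableEq V]
    (ℬ : Finset (Finset V)) (hℬ : ∀ B ∈ ℬ, B.Nonempty)
    (β : ℝ) (hβ : 0 < β)
    (P : Finset V → ℝ → ℝ)
    (hPmeas : ∀ B, Measurable (P B))
    (hPnonneg : ∀ B x, 0 ≤ P B x)
    (hPone : ∀ B, ∫ x, P B x = 1)
    (A : Finset V) (hA : A ∈ ℬ)
    (βNL : ℝ)
    (hPasym : ∀ x : ℝ, P A (-x) = Real.exp (-2 * βNL * x) * P A x)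
    (f : ℝ → ℝ) (hfmeas : Measurable f) (hfeven : ∀ x, f (-x) = f x)
    (hfnonneg : ∀ x, 0 ≤ f x)
    -- finiteness of the quenched average
    (hint : Integrable (fun J : ℬ → ℝ => f (J ⟨A, hA⟩) * GammaQ β βNL ℬ A hA J)
      (quenchedMeasure ℬ P)) :
    0 ≤ ∫ J, f (J ⟨A, hA⟩) * GammaQ β βNL ℬ A hA J ∂(quenchedMeasure ℬ P) := by
  have hPint : ∀ B, Integrable (P B) := fun B =>
    Integrable.of_integral_ne_zero (by rw [hPone B]; exact one_ne_zero)
  set a : ℬ := ⟨A, hA⟩ with ha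
  set D : (ℬ → ℝ) → ℝ := fun J => ∏ B : ℬ, P (B : Finset V) (J B) with hD
  set T : (ℬ → ℝ) → ℬ → ℝ := fun J => Function.update J a (-J a) with hT
  have hDnn : ∀ J, 0 ≤ D J := fun J => Finset.prod_nonneg fun B _ => hPnonneg _ _
  have hDmeas : Measurable D :=
    Finset.measurable_prod _ fun B _ => (hPmeas B).comp (measurable_pi_apply B)
  have hμ : quenchedMeasure ℬ P = volume.withDensity fun J => ENNReal.ofReal (D J) :=
    pi_withDensity_ofReal (fun B : ℬ => P B) (fun B => hPnonneg B) fun B => hPint B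
  have hTmp : MeasurePreserving T := measurePreserving_update_neg a
  have hTemb : MeasurableEmbedding T := by
    have hinv : Function.Involutive T := fun J => by simp [hT]
    exact (MeasurableEquiv.ofInvolutive T hinv hTmp.measurable).measurableEmbedding
  have hDT : ∀ J, D (T J) = Real.exp (-2 * βNL * J a) * D J := by
    intro J
    simp only [hD, hT]
    rw [← Finset.mul_prod_erase _ _ (Finset.mem_univ a),
      ← Finset.mul_prod_erase _ (fun B : ℬ => P (B : Finset V) (J B)) (Finset.mem_univ a),
      Function.update_self, hPasym, mul_assoc]
    congr 2
    refine Finset.prod_congr rfl fun B hB => ?_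
    rw [Function.update_of_ne (Finset.ne_of_mem_erase hB)]
  set g : (ℬ → ℝ) → ℝ := fun J => D J * (f (J a) * GammaQ β βNL ℬ A hA J) with hg
  have hofReal : Measurable fun J => ENNReal.ofReal (D J) := hDmeas.ennreal_ofReal
  have hlt : ∀ᵐ J : ℬ → ℝ, ENNReal.ofReal (D J) < ⊤ :=
    ae_of_all _ fun J => ENNReal.ofReal_lt_top
  have hgint : Integrable g := by
    rw [hμ, integrable_withDensity_iff_integrable_smul' hofReal hlt] at hint
    simpa only [ENNReal.toReal_ofReal (hDnn _), smul_eq_mul] using hint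
  have hgTint : Integrable fun J => g (T J) := hTmp.integrable_comp_of_integrable hgint
  have hsum : 0 ≤ ∫ J, (g J + g (T J)) := by
    refine integral_nonneg fun J => ?_
    have h := mul_nonneg (mul_nonneg (hDnn J) (hfnonneg (J a)))
      (GammaQ_add_update_neg_nonneg hβ βNL ℬ A hA J)
    refine h.trans_eq ?_
    simp only [hg, hDT]
    simp only [hT, Function.update_self, hfeven]
    ring
  rw [integral_add hgint hgTint, hTmp.integral_comp hTemb] at hsum
  rw [hμ, integral_withDensity_eq_integral_toReal_smul hofReal hlt]
  simp only [ENNReal.toReal_ofReal (hDnn _), smul_eq_mul]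
  linarith
end

section
/- Suppose every coupling J_B (B ∈ 𝔅) is independently Gaussian with mean J_{0,B} ∈ ℝ and variance Λ_B² > 0, and fix A ∈ 𝔅. Then the quenched average of the fourth power of the correlation function has the lower bound ((8β²Λ_A² − 3)/(6β²Λ_A²)) · ( E[ ⟨σ_A⟩_J² ]_{{J_{0,B}, Λ_B²}} − E[ tanh²(β J) ]_{{0, Λ_A²}} ) + E[ tanh⁴(β J) ]_{{0, Λ_A²}} ≤ E[ ⟨σ_A⟩_J⁴ ]_{{J_{0,B}, Λ_B²}}. -/
open MeasureTheory Real Finset ProbabilityTheory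

/-- The product measure of independent Gaussian couplings `J_B ~ N(J_{0,B}, Λ_B²)`. -/
noncomputable def gaussQuenched {V : Type} (ℬ : Finset (Finset V))
    (J0 : Finset V → ℝ) (Λ : Finset V → NNReal) : Measure (ℬ → ℝ) :=
  Measure.pi fun B => gaussianReal (J0 (B : Finset V)) (Λ (B : Finset V) ^ 2)

namespace IsingFourth

lemma hasDerivAt_tanh (x : ℝ) : HasDerivAt Real.tanh (1 - Real.tanh x ^ 2) x := by
  have h := (Real.hasDerivAt_sinh x).div (Real.hasDerivAt_cosh x) (Real.cosh_pos x).ne'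
  have hfun : Real.tanh = fun y => Real.sinh y / Real.cosh y :=
    funext Real.tanh_eq_sinh_div_cosh
  have hc := (Real.cosh_pos x).ne'
  rw [hfun]
  refine h.congr_deriv ?_
  field_simp

lemma continuous_tanh : Continuous Real.tanh :=
  continuous_iff_continuousAt.2 fun x => (hasDerivAt_tanh x).continuousAt

lemma tanh_sq_le_tanh_sq {x y : ℝ} (h : |x| ≤ |y|) : Real.tanh x ^ 2 ≤ Real.tanh y ^ 2 := by
  have hx := Real.cosh_pos x
  have hy := Real.cosh_pos y
  have hcosh : Real.cosh x ≤ Real.cosh y := Real.cosh_le_cosh.2 h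
  have key : ∀ z : ℝ, Real.tanh z ^ 2 = 1 - 1 / Real.cosh z ^ 2 := fun z => by
    have hz := (Real.cosh_pos z).ne'
    rw [Real.tanh_eq_sinh_div_cosh]
    field_simp
    linarith [Real.cosh_sq z]
  rw [key, key]
  gcongr

/-- A one-dimensional Anderson inequality: shifting a radially increasing function increases its
integral against a radially decreasing weight. -/
lemma integral_mul_le_integral_shift_mul {q w : ℝ → ℝ}
    (hq : ∀ x y, |x| ≤ |y| → q x ≤ q y) (hw : ∀ x y, |x| ≤ |y| → w y ≤ w x) (b : ℝ)
    (hi : Integrable fun x => q x * w x) (hib : Integrable fun x => q (x + b) * w x) :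
    ∫ x, q x * w x ≤ ∫ x, q (x + b) * w x := by
  have hqe : ∀ x, q (-x) = q x := fun x =>
    le_antisymm (hq _ _ (abs_neg x).le) (hq _ _ (abs_neg x).ge)
  have hwe : ∀ x, w (-x) = w x := fun x =>
    le_antisymm (hw _ _ (abs_neg x).ge) (hw _ _ (abs_neg x).le)
  have hrefl : (fun x => q x * w (x + b)) = fun x => q (-b - x + b) * w (-b - x) := by
    funext x
    rw [show -b - x + b = -x by ring, show -b - x = -(x + b) by ring, hqe, hwe]
  have hic : Integrable fun x => q x * w (x + b) := by
    rw [hrefl]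
    exact hib.comp_sub_left (-b)
  have hid : Integrable fun x => q (x + b) * w (x + b) := hi.comp_add_right b
  have e1 : ∫ x, q x * w (x + b) = ∫ x, q (x + b) * w x := by
    rw [hrefl]
    exact integral_sub_left_eq_self (fun x => q (x + b) * w x) volume (-b)
  have e2 : ∫ x, q (x + b) * w (x + b) = ∫ x, q x * w x :=
    integral_add_right_eq_self (fun x => q x * w x) b
  have hpos : 0 ≤ ∫ x, (q (x + b) - q x) * (w x - w (x + b)) := by
    refine integral_nonneg fun x => ?_
    rcases le_total |x| |x + b| with h | h
    · exact mul_nonneg (sub_nonneg.2 (hq _ _ h)) (sub_nonneg.2 (hw _ _ h))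
    · exact mul_nonneg_of_nonpos_of_nonpos (sub_nonpos.2 (hq _ _ h)) (sub_nonpos.2 (hw _ _ h))
  have hexp : ∫ x, (q (x + b) - q x) * (w x - w (x + b))
      = ((∫ x, q (x + b) * w x) + ∫ x, q x * w (x + b))
        - ((∫ x, q x * w x) + ∫ x, q (x + b) * w (x + b)) := by
    rw [← integral_add hib hic, ← integral_add hi hid, ← integral_sub]
    · congr 1
      funext x
      ring
    · exact hib.add hic
    · exact hi.add hid
  rw [e1, e2] at hexp
  linarith

lemma integrable_bounded_mul_pow_mul_gaussianPDFReal {v : NNReal} (hv : v ≠ 0) (k : ℕ)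
    {f : ℝ → ℝ} (hf : Continuous f) {C : ℝ} (hC : ∀ x, |f x| ≤ C) :
    Integrable fun x => f x * (x ^ k * gaussianPDFReal 0 v x) := by
  have hv' : (0 : ℝ) < v := NNReal.coe_pos.2 (pos_iff_ne_zero.2 hv)
  have hi := integrable_rpow_mul_exp_neg_mul_sq (b := 1 / (2 * v)) (by positivity) (s := k)
    (by have : (0 : ℝ) ≤ k := k.cast_nonneg
        linarith)
  have hp : Integrable fun x : ℝ => x ^ k * gaussianPDFReal 0 v x := by
    refine (hi.const_mul (√(2 * π * v))⁻¹).congr (ae_of_all _ fun x => ?_)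
    simp only [gaussianPDFReal, Real.rpow_natCast, sub_zero]
    rw [show -(1 / (2 * (v : ℝ))) * x ^ 2 = -x ^ 2 / (2 * v) by ring]
    ring
  exact hp.bdd_mul hf.aestronglyMeasurable (ae_of_all _ hC)

lemma hasDerivAt_gaussianPDFReal {v : NNReal} (hv : v ≠ 0) (x : ℝ) :
    HasDerivAt (gaussianPDFReal 0 v) (-(x / v) * gaussianPDFReal 0 v x) x := by
  have hv' : (v : ℝ) ≠ 0 := NNReal.coe_ne_zero.2 hv
  have h1 : HasDerivAt (fun y : ℝ => -(y - 0) ^ 2 / (2 * v)) (-(x / v)) x := by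
    have h := ((((hasDerivAt_id x).sub_const 0).pow 2).neg).div_const (2 * (v : ℝ))
    refine h.congr_deriv ?_
    simp
    field_simp
  have h2 := (h1.exp).const_mul (√(2 * π * v))⁻¹
  refine h2.congr_deriv ?_
  simp only [gaussianPDFReal]
  ring

/-- Gaussian integration by parts, applied twice to `tanh²`, whose second derivative is
`2 - 8 tanh² + 6 tanh⁴`. -/
lemma integral_tanh_pow_four_sub {v : NNReal} (hv : v ≠ 0) {β : ℝ} (hβ : 0 < β) (a : ℝ) :
    ∫ x, (Real.tanh (β * x + a) ^ 4
        - (8 * β ^ 2 * v - 3) / (6 * β ^ 2 * v) * Real.tanh (β * x + a) ^ 2) ∂(gaussianReal 0 v)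
      = 1 / (6 * β ^ 2 * v ^ 2)
          * (∫ x, Real.tanh (β * x + a) ^ 2 * ((x ^ 2 + 2 * v) * gaussianPDFReal 0 v x)) - 1 / 3 := by
  have hv' : (0 : ℝ) < v := NNReal.coe_pos.2 (pos_iff_ne_zero.2 hv)
  set T : ℝ → ℝ := fun x => Real.tanh (β * x + a) with hT
  set p := gaussianPDFReal 0 v with hp
  have hTc : Continuous T := continuous_tanh.comp (by fun_prop)
  have hT1 : ∀ x, |T x| ≤ 1 := fun x => (Real.abs_tanh_lt_one _).le
  have hTn : ∀ n x, |T x ^ n| ≤ 1 := fun n x => by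
    rw [abs_pow]
    exact pow_le_one₀ (abs_nonneg _) (hT1 x)
  have hTd : ∀ x, HasDerivAt T (β * (1 - T x ^ 2)) x := fun x => by
    have hl : HasDerivAt (fun y : ℝ => β * y + a) β x := by
      simpa using ((hasDerivAt_id x).const_mul β).add_const a
    have h := (hasDerivAt_tanh (β * x + a)).comp x hl
    rw [mul_comm]
    exact h
  have hI : ∀ n k : ℕ, Integrable fun x => T x ^ n * (x ^ k * p x) := fun n k =>
    integrable_bounded_mul_pow_mul_gaussianPDFReal hv k (hTc.pow n) (hTn n)
  have hpd := fun x => hasDerivAt_gaussianPDFReal hv x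
  have hderiv : ∀ x, HasDerivAt
      (fun x => 2 * β * (T x - T x ^ 3) * p x + T x ^ 2 * (x / v * p x))
      (β ^ 2 * (2 - 8 * T x ^ 2 + 6 * T x ^ 4) * p x
        - T x ^ 2 * ((x ^ 2 / v ^ 2 - 1 / v) * p x)) x := fun x => by
    have h := ((((hTd x).sub ((hTd x).pow 3)).const_mul (2 * β)).mul (hpd x)).add
      (((hTd x).pow 2).mul (((hasDerivAt_id x).div_const (v : ℝ)).mul (hpd x)))
    refine h.congr_deriv ?_
    simp
    field_simp
    ring
  have hJ : Integrable fun x => β ^ 2 * (2 - 8 * T x ^ 2 + 6 * T x ^ 4) * p x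
        - T x ^ 2 * ((x ^ 2 / v ^ 2 - 1 / v) * p x) := by
    refine (((((hI 0 0).const_mul (2 * β ^ 2)).sub ((hI 2 0).const_mul (8 * β ^ 2))).add
      ((hI 4 0).const_mul (6 * β ^ 2))).sub (((hI 2 2).const_mul (1 / (v : ℝ) ^ 2)).sub
        ((hI 2 0).const_mul (1 / (v : ℝ))))).congr (ae_of_all _ fun x => ?_)
    simp only [Pi.add_apply, Pi.sub_apply]
    ring
  have hK : Integrable fun x => 2 * β * (T x - T x ^ 3) * p x + T x ^ 2 * (x / v * p x) := by
    refine ((((hI 1 0).sub (hI 3 0)).const_mul (2 * β)).add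
      ((hI 2 1).const_mul (1 / (v : ℝ)))).congr (ae_of_all _ fun x => ?_)
    simp only [Pi.add_apply, Pi.sub_apply]
    ring
  have hzero := integral_eq_zero_of_hasDerivAt_of_integrable hderiv hJ hK
  have hone : ∫ x, p x = 1 := integral_gaussianPDFReal_eq_one 0 hv
  have hpi : Integrable p := integrable_gaussianPDFReal 0 v
  have hW : Integrable fun x => T x ^ 2 * ((x ^ 2 + 2 * v) * p x) := by
    refine ((hI 2 2).add ((hI 2 0).const_mul (2 * (v : ℝ)))).congr (ae_of_all _ fun x => ?_)
    simp only [Pi.add_apply]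
    ring
  rw [integral_gaussianReal_eq_integral_smul hv]
  have hsplit : (fun x => p x • (T x ^ 4 - (8 * β ^ 2 * v - 3) / (6 * β ^ 2 * v) * T x ^ 2))
      = fun x => (1 / (6 * β ^ 2 * v ^ 2) * (T x ^ 2 * ((x ^ 2 + 2 * v) * p x)) - 1 / 3 * p x)
        + 1 / (6 * β ^ 2) * (β ^ 2 * (2 - 8 * T x ^ 2 + 6 * T x ^ 4) * p x
          - T x ^ 2 * ((x ^ 2 / v ^ 2 - 1 / v) * p x)) := by
    funext x
    rw [smul_eq_mul]
    field_simp
    ring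
  have hS : Integrable fun x =>
      1 / (6 * β ^ 2 * v ^ 2) * (T x ^ 2 * ((x ^ 2 + 2 * v) * p x)) - 1 / 3 * p x :=
    (hW.const_mul _).sub (hpi.const_mul _)
  calc ∫ x, p x • (T x ^ 4 - (8 * β ^ 2 * v - 3) / (6 * β ^ 2 * v) * T x ^ 2)
      = _ := by rw [hsplit, integral_add hS (hJ.const_mul _),
                  integral_sub (hW.const_mul _) (hpi.const_mul _)]
    _ = _ := by rw [integral_const_mul, integral_const_mul, integral_const_mul, hzero, hone]; ring

lemma sq_add_mul_gaussianPDFReal_antitone {v : NNReal} (hv : v ≠ 0) {x y : ℝ} (h : |x| ≤ |y|) :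
    (y ^ 2 + 2 * v) * gaussianPDFReal 0 v y ≤ (x ^ 2 + 2 * v) * gaussianPDFReal 0 v x := by
  have hv' : (0 : ℝ) < v := NNReal.coe_pos.2 (pos_iff_ne_zero.2 hv)
  have hxy : x ^ 2 ≤ y ^ 2 := sq_le_sq.2 h
  have hexp : (y ^ 2 + 2 * v) * rexp (-y ^ 2 / (2 * v))
      ≤ (x ^ 2 + 2 * v) * rexp (-x ^ 2 / (2 * v)) := by
    have h1 : (y ^ 2 - x ^ 2) / (2 * v) + 1 ≤ rexp ((y ^ 2 - x ^ 2) / (2 * v)) :=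
      Real.add_one_le_exp _
    have h2 : rexp (-x ^ 2 / (2 * v))
        = rexp ((y ^ 2 - x ^ 2) / (2 * v)) * rexp (-y ^ 2 / (2 * v)) := by
      rw [← Real.exp_add]
      congr 1
      ring
    rw [h2, ← mul_assoc]
    refine mul_le_mul_of_nonneg_right ?_ (Real.exp_pos _).le
    refine le_trans ?_ (mul_le_mul_of_nonneg_left h1 (by positivity))
    have h3 : (x ^ 2 + 2 * v) * ((y ^ 2 - x ^ 2) / (2 * v) + 1)
        = y ^ 2 + 2 * v + x ^ 2 * (y ^ 2 - x ^ 2) / (2 * v) := by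
      field_simp
      ring
    rw [h3]
    have : 0 ≤ x ^ 2 * (y ^ 2 - x ^ 2) / (2 * v) :=
      div_nonneg (mul_nonneg (sq_nonneg x) (sub_nonneg.2 hxy)) (by positivity)
    linarith
  simp only [gaussianPDFReal, sub_zero]
  calc _ = (√(2 * π * v))⁻¹ * ((y ^ 2 + 2 * v) * rexp (-y ^ 2 / (2 * v))) := by ring
    _ ≤ (√(2 * π * v))⁻¹ * ((x ^ 2 + 2 * v) * rexp (-x ^ 2 / (2 * v))) := by gcongr
    _ = _ := by ring

/-- For a Gaussian coupling, the fourth-moment combination is minimal at zero external field. -/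
lemma integral_tanh_combination_zero_le {v : NNReal} (hv : v ≠ 0) {β : ℝ} (hβ : 0 < β) (a : ℝ) :
    ∫ x, (Real.tanh (β * x) ^ 4
        - (8 * β ^ 2 * v - 3) / (6 * β ^ 2 * v) * Real.tanh (β * x) ^ 2) ∂(gaussianReal 0 v)
      ≤ ∫ x, (Real.tanh (β * x + a) ^ 4
        - (8 * β ^ 2 * v - 3) / (6 * β ^ 2 * v) * Real.tanh (β * x + a) ^ 2)
          ∂(gaussianReal 0 v) := by
  have hi : ∀ a : ℝ, Integrable fun x =>
      Real.tanh (β * x + a) ^ 2 * ((x ^ 2 + 2 * v) * gaussianPDFReal 0 v x) := fun a => by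
    have hc : Continuous fun x : ℝ => Real.tanh (β * x + a) ^ 2 :=
      (continuous_tanh.comp (by fun_prop)).pow 2
    have hb : ∀ x : ℝ, |Real.tanh (β * x + a) ^ 2| ≤ 1 := fun x => by
      rw [abs_of_nonneg (sq_nonneg _)]
      exact (Real.tanh_sq_lt_one _).le
    refine ((integrable_bounded_mul_pow_mul_gaussianPDFReal hv 2 hc hb).add
      ((integrable_bounded_mul_pow_mul_gaussianPDFReal hv 0 hc hb).const_mul (2 * (v : ℝ)))).congr
        (ae_of_all _ fun x => ?_)
    simp only [Pi.add_apply]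
    ring
  have hshift : ∀ x : ℝ, β * (x + a / β) = β * x + a := fun x => by field_simp
  have key := integral_mul_le_integral_shift_mul
    (q := fun x => Real.tanh (β * x) ^ 2)
    (w := fun x => (x ^ 2 + 2 * v) * gaussianPDFReal 0 v x)
    (fun x y h => tanh_sq_le_tanh_sq (by
      rw [abs_mul, abs_mul]
      exact mul_le_mul_of_nonneg_left h (abs_nonneg β)))
    (fun x y h => sq_add_mul_gaussianPDFReal_antitone hv h) (a / β)
    (by simpa using hi 0) (by simpa only [hshift] using hi a)
  simp only [hshift] at key
  have h0 := integral_tanh_pow_four_sub hv hβ 0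
  simp only [add_zero] at h0
  rw [h0, integral_tanh_pow_four_sub hv hβ a]
  gcongr

lemma integral_tanh_combination_le {v : NNReal} (hv : v ≠ 0) {β : ℝ} (hβ : 0 < β) (m a : ℝ) :
    ∫ x, (Real.tanh (β * x) ^ 4
        - (8 * β ^ 2 * v - 3) / (6 * β ^ 2 * v) * Real.tanh (β * x) ^ 2) ∂(gaussianReal 0 v)
      ≤ ∫ x, (Real.tanh (β * x + a) ^ 4
        - (8 * β ^ 2 * v - 3) / (6 * β ^ 2 * v) * Real.tanh (β * x + a) ^ 2)
          ∂(gaussianReal m v) := by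
  have hmap : gaussianReal m v = (gaussianReal 0 v).map (fun x => x + m) := by
    rw [gaussianReal_map_add_const, zero_add]
  have hc : Continuous fun x : ℝ => Real.tanh (β * x + a) ^ 4
        - (8 * β ^ 2 * v - 3) / (6 * β ^ 2 * v) * Real.tanh (β * x + a) ^ 2 := by
    have : Continuous fun x : ℝ => Real.tanh (β * x + a) := continuous_tanh.comp (by fun_prop)
    fun_prop
  rw [hmap, integral_map (by fun_prop) hc.aestronglyMeasurable]
  refine (integral_tanh_combination_zero_le hv hβ (β * m + a)).trans_eq ?_
  simp only [mul_add, add_assoc]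

/-- Resampling one coordinate of a product probability measure preserves it. -/
lemma measurePreserving_update {ι : Type*} [Fintype ι] [DecidableEq ι] (μ : ι → Measure ℝ)
    [∀ i, IsProbabilityMeasure (μ i)] (i : ι) :
    MeasurePreserving (fun z : (ι → ℝ) × ℝ => Function.update z.1 i z.2)
      ((Measure.pi μ).prod (μ i)) (Measure.pi μ) := by
  have hm : Measurable fun z : (ι → ℝ) × ℝ => Function.update z.1 i z.2 := by
    refine measurable_pi_lambda _ fun j => ?_
    by_cases h : j = i
    · subst h
      simpa using measurable_snd
    · simp only [Function.update_of_ne h]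
      exact (measurable_pi_apply j).comp measurable_fst
  refine ⟨hm, (Measure.pi_eq fun s hs => ?_).symm⟩
  have hpre : (fun z : (ι → ℝ) × ℝ => Function.update z.1 i z.2) ⁻¹' Set.univ.pi s
      = (Set.univ.pi (Function.update s i Set.univ)) ×ˢ s i := by
    ext z
    simp only [Set.mem_preimage, Set.mem_pi, Set.mem_univ, true_imp_iff, Set.mem_prod]
    constructor
    · intro h
      refine ⟨fun j => ?_, by simpa using h i⟩
      by_cases hj : j = i
      · subst hj
        simp
      · simpa [Function.update_of_ne hj] using h j
    · rintro ⟨h1, h2⟩ j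
      by_cases hj : j = i
      · subst hj
        simpa using h2
      · simpa [Function.update_of_ne hj] using h1 j
  rw [Measure.map_apply hm (MeasurableSet.univ_pi hs), hpre, Measure.prod_prod, Measure.pi_pi,
    ← Finset.mul_prod_erase _ _ (Finset.mem_univ i),
    ← Finset.mul_prod_erase Finset.univ (fun j => μ j (s j)) (Finset.mem_univ i)]
  rw [Function.update_self, measure_univ, one_mul, mul_comm]
  congr 1
  refine Finset.prod_congr rfl fun j hj => ?_
  rw [Function.update_of_ne (Finset.ne_of_mem_erase hj)]

lemma sigmaSet_eq_one_or {V : Type} [DecidableEq V] (σ : V → Bool) (B : Finset V) :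
    sigmaSet σ B = 1 ∨ sigmaSet σ B = -1 := by
  unfold sigmaSet
  induction B using Finset.induction_on with
  | empty => simp
  | insert i s hi ih =>
    rw [Finset.prod_insert hi]
    have hs : spinVal (σ i) = 1 ∨ spinVal (σ i) = -1 := by
      cases σ i <;> simp [spinVal]
    rcases ih with h | h <;> rcases hs with h' | h' <;> simp [h, h']

lemma exists_sigmaSet_eq_neg_one {V : Type} [DecidableEq V] {A : Finset V} (hA : A.Nonempty) :
    ∃ σ : V → Bool, sigmaSet σ A = -1 := by
  obtain ⟨i, hi⟩ := hA
  refine ⟨fun j => decide (j ≠ i), ?_⟩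
  rw [sigmaSet, ← Finset.mul_prod_erase _ _ hi, Finset.prod_eq_one fun j hj => ?_]
  · simp [spinVal]
  · simp [spinVal, Finset.ne_of_mem_erase hj]

lemma sum_exp_pos {V : Type} [Fintype V] [DecidableEq V] (g : (V → Bool) → ℝ) : 0 < ∑ σ, rexp (g σ) :=
  Finset.sum_pos (fun _ _ => Real.exp_pos _) Finset.univ_nonempty

/-- As a function of its own coupling, `⟨σ_A⟩` is a hyperbolic tangent in an effective field. -/
lemma exists_gibbsAvg_update_eq_tanh {V : Type} [Fintype V] [DecidableEq V]
    (ℬ : Finset (Finset V)) (β : ℝ) (A : ℬ)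
    (hA : (A : Finset V).Nonempty) (J : ℬ → ℝ) :
    ∃ a : ℝ, ∀ x : ℝ, gibbsAvg β ℬ (Function.update J A x) A = Real.tanh (β * x + a) := by
  set R : (V → Bool) → ℝ := fun σ => rexp (β * ∑ B ∈ Finset.univ.erase A, J B * sigmaSet σ B)
    with hR
  set P : ℝ := ∑ σ with sigmaSet σ (A : Finset V) = 1, R σ with hP
  set N : ℝ := ∑ σ with ¬ sigmaSet σ (A : Finset V) = 1, R σ with hN
  have hRpos : ∀ σ, 0 < R σ := fun σ => Real.exp_pos _
  have hPpos : 0 < P := Finset.sum_pos (fun σ _ => hRpos σ)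
    ⟨fun _ => true, Finset.mem_filter.2 ⟨Finset.mem_univ _, by simp [sigmaSet, spinVal]⟩⟩
  have hNpos : 0 < N := by
    obtain ⟨σ, hσ⟩ := exists_sigmaSet_eq_neg_one hA
    exact Finset.sum_pos (fun σ _ => hRpos σ)
      ⟨σ, Finset.mem_filter.2 ⟨Finset.mem_univ _, by norm_num [hσ]⟩⟩
  have hw : ∀ x σ, rexp (β * ∑ B : ℬ, Function.update J A x B * sigmaSet σ (B : Finset V))
      = rexp (β * x * sigmaSet σ (A : Finset V)) * R σ := fun x σ => by
    rw [hR, ← Real.exp_add, ← Finset.add_sum_erase _ _ (Finset.mem_univ A), Function.update_self,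
      Finset.sum_congr rfl fun B hB => by rw [Function.update_of_ne (Finset.ne_of_mem_erase hB)]]
    congr 1
    ring
  have hneg : ∀ σ, ¬ sigmaSet σ (A : Finset V) = 1 → sigmaSet σ (A : Finset V) = -1 := fun σ h =>
    (sigmaSet_eq_one_or σ A).resolve_left h
  have hnum : ∀ x, ∑ σ : V → Bool, sigmaSet σ (A : Finset V)
      * rexp (β * ∑ B : ℬ, Function.update J A x B * sigmaSet σ (B : Finset V))
      = rexp (β * x) * P - rexp (-(β * x)) * N := fun x => by
    rw [← Finset.sum_filter_add_sum_filter_not _ (fun σ => sigmaSet σ (A : Finset V) = 1),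
      sub_eq_add_neg, ← neg_mul, hP, hN, Finset.mul_sum, Finset.mul_sum]
    congr 1
    · refine Finset.sum_congr rfl fun σ hσ => ?_
      rw [hw, (Finset.mem_filter.1 hσ).2]
      simp
    · refine Finset.sum_congr rfl fun σ hσ => ?_
      rw [hw, hneg σ (Finset.mem_filter.1 hσ).2]
      simp
  have hden : ∀ x, ∑ σ : V → Bool,
      rexp (β * ∑ B : ℬ, Function.update J A x B * sigmaSet σ (B : Finset V))
      = rexp (β * x) * P + rexp (-(β * x)) * N := fun x => by
    rw [← Finset.sum_filter_add_sum_filter_not _ (fun σ => sigmaSet σ (A : Finset V) = 1),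
      hP, hN, Finset.mul_sum, Finset.mul_sum]
    congr 1
    · refine Finset.sum_congr rfl fun σ hσ => ?_
      rw [hw, (Finset.mem_filter.1 hσ).2]
      simp
    · refine Finset.sum_congr rfl fun σ hσ => ?_
      rw [hw, hneg σ (Finset.mem_filter.1 hσ).2]
      simp
  refine ⟨(Real.log P - Real.log N) / 2, fun x => ?_⟩
  set g := rexp ((Real.log P + Real.log N) / 2) with hg
  have hgpos : 0 < g := Real.exp_pos _
  have hPe : rexp (β * x) * P = g * rexp (β * x + (Real.log P - Real.log N) / 2) := by
    nth_rewrite 1 [← Real.exp_log hPpos]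
    rw [hg, ← Real.exp_add, ← Real.exp_add]
    congr 1
    ring
  have hNe : rexp (-(β * x)) * N = g * rexp (-(β * x + (Real.log P - Real.log N) / 2)) := by
    nth_rewrite 1 [← Real.exp_log hNpos]
    rw [hg, ← Real.exp_add, ← Real.exp_add]
    congr 1
    ring
  rw [gibbsAvg, hnum, hden, hPe, hNe, ← mul_sub, ← mul_add,
    mul_div_mul_left _ _ hgpos.ne', Real.tanh_eq]

lemma continuous_gibbsAvg {V : Type} [Fintype V] [DecidableEq V]
    (ℬ : Finset (Finset V)) (β : ℝ) (A : Finset V) :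
    Continuous fun J : ℬ → ℝ => gibbsAvg β ℬ J A := by
  unfold gibbsAvg
  refine Continuous.div (by fun_prop) (by fun_prop) fun J => (sum_exp_pos _).ne'

lemma abs_gibbsAvg_le_one {V : Type} [Fintype V] [DecidableEq V]
    (ℬ : Finset (Finset V)) (β : ℝ) (J : ℬ → ℝ) (A : Finset V) :
    |gibbsAvg β ℬ J A| ≤ 1 := by
  unfold gibbsAvg
  rw [abs_div, abs_of_pos (sum_exp_pos _)]
  refine div_le_one_of_le₀ ((Finset.abs_sum_le_sum_abs _ _).trans ?_) (sum_exp_pos _).le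
  refine Finset.sum_le_sum fun σ _ => ?_
  rw [abs_mul, abs_of_pos (Real.exp_pos _)]
  rcases sigmaSet_eq_one_or σ A with h | h <;> simp [h]

end IsingFourth

/-- **Fourth-power correlation inequality.** For independent Gaussian couplings
`J_B ~ N(J_{0,B}, Λ_B²)`,
`((8β²Λ_A² - 3)/(6β²Λ_A²)) (E[⟨σ_A⟩_J²] - E[tanh²(βJ)]_{N(0,Λ_A²)})
  + E[tanh⁴(βJ)]_{N(0,Λ_A²)} ≤ E[⟨σ_A⟩_J⁴]`. -/
theorem gaussian_correlation_fourth_lower_bound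
    {V : Type} [Fintype V] [DecidableEq V]
    (ℬ : Finset (Finset V)) (hℬ : ∀ B ∈ ℬ, B.Nonempty)
    (β : ℝ) (hβ : 0 < β)
    (J0 : Finset V → ℝ) (Λ : Finset V → NNReal) (hΛ : ∀ B, 0 < Λ B)
    (A : Finset V) (hA : A ∈ ℬ) :
    ((8 * β ^ 2 * (Λ A : ℝ) ^ 2 - 3) / (6 * β ^ 2 * (Λ A : ℝ) ^ 2))
        * ((∫ J, gibbsAvg β ℬ J A ^ 2 ∂(gaussQuenched ℬ J0 Λ))
            - ∫ x, Real.tanh (β * x) ^ 2 ∂(gaussianReal 0 (Λ A ^ 2)))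
        + ∫ x, Real.tanh (β * x) ^ 4 ∂(gaussianReal 0 (Λ A ^ 2))
      ≤ ∫ J, gibbsAvg β ℬ J A ^ 4 ∂(gaussQuenched ℬ J0 Λ) := by
  have hv : (Λ A ^ 2 : NNReal) ≠ 0 := pow_ne_zero 2 (hΛ A).ne'
  set c : ℝ := (8 * β ^ 2 * (Λ A : ℝ) ^ 2 - 3) / (6 * β ^ 2 * (Λ A : ℝ) ^ 2) with hc
  let μ : ℬ → Measure ℝ := fun B => gaussianReal (J0 (B : Finset V)) (Λ (B : Finset V) ^ 2)
  have hμ : gaussQuenched ℬ J0 Λ = Measure.pi μ := rfl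
  let i : ℬ := ⟨A, hA⟩
  have hg : Continuous fun J : ℬ → ℝ => gibbsAvg β ℬ J A := IsingFourth.continuous_gibbsAvg ℬ β A
  have hgn : ∀ n : ℕ, Integrable (fun J => gibbsAvg β ℬ J A ^ n) (Measure.pi μ) := fun n =>
    Integrable.of_bound (hg.pow n).aestronglyMeasurable 1 (ae_of_all _ fun J => by
      rw [norm_pow]
      exact pow_le_one₀ (norm_nonneg _) (IsingFourth.abs_gibbsAvg_le_one ℬ β J A))
  have htn : ∀ n : ℕ, Integrable (fun x => Real.tanh (β * x) ^ n) (gaussianReal 0 (Λ A ^ 2)) :=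
    fun n => Integrable.of_bound
      ((IsingFourth.continuous_tanh.comp (continuous_const_mul β)).pow n).aestronglyMeasurable 1
      (ae_of_all _ fun x => by
        rw [norm_pow]
        exact pow_le_one₀ (norm_nonneg _) (Real.abs_tanh_lt_one _).le)
  have hF : Integrable (fun J => gibbsAvg β ℬ J A ^ 4 - c * gibbsAvg β ℬ J A ^ 2) (Measure.pi μ) :=
    (hgn 4).sub ((hgn 2).const_mul c)
  have hmp := IsingFourth.measurePreserving_update μ i
  have hcomp : Integrable (fun z : (ℬ → ℝ) × ℝ => gibbsAvg β ℬ (Function.update z.1 i z.2) A ^ 4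
      - c * gibbsAvg β ℬ (Function.update z.1 i z.2) A ^ 2) ((Measure.pi μ).prod (μ i)) :=
    hmp.integrable_comp_of_integrable hF
  have hdis : ∫ J, (gibbsAvg β ℬ J A ^ 4 - c * gibbsAvg β ℬ J A ^ 2) ∂(Measure.pi μ)
      = ∫ J, ∫ x, (gibbsAvg β ℬ (Function.update J i x) A ^ 4
          - c * gibbsAvg β ℬ (Function.update J i x) A ^ 2) ∂(μ i) ∂(Measure.pi μ) := by
    rw [integral_integral hcomp]
    conv_lhs => rw [← hmp.map_eq]
    exact integral_map hmp.measurable.aemeasurable (by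
      rw [hmp.map_eq]
      exact hF.aestronglyMeasurable)
  have hle : ∫ x, (Real.tanh (β * x) ^ 4 - c * Real.tanh (β * x) ^ 2) ∂(gaussianReal 0 (Λ A ^ 2))
      ≤ ∫ J, (gibbsAvg β ℬ J A ^ 4 - c * gibbsAvg β ℬ J A ^ 2) ∂(Measure.pi μ) := by
    rw [hdis]
    calc _ = ∫ _J : ℬ → ℝ, (∫ x, (Real.tanh (β * x) ^ 4 - c * Real.tanh (β * x) ^ 2)
            ∂(gaussianReal 0 (Λ A ^ 2))) ∂(Measure.pi μ) := by simp
      _ ≤ _ := by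
        refine integral_mono (integrable_const _) hcomp.integral_prod_left fun J => ?_
        obtain ⟨a, ha⟩ := IsingFourth.exists_gibbsAvg_update_eq_tanh ℬ β i (hℬ A hA) J
        have h := IsingFourth.integral_tanh_combination_le hv hβ (J0 A) a
        rw [NNReal.coe_pow, ← hc] at h
        simpa only [Function.comp_apply, ← ha] using h
  rw [integral_sub (hgn 4) ((hgn 2).const_mul c), integral_sub (htn 4) ((htn 2).const_mul c),
    integral_const_mul, integral_const_mul] at hle
  rw [hμ]
  linarith
end
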